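/- arXiv:2510.26522 — 7 statements merged into one kernel-verified Lean document; each statement's English description precedes it below -/
import Mathlib

section
/- Let P be a quasicontinuous domain that fails to be quasialgebraic. Then there exists a surjective monotone function f : P → [0,1] that is Lawson continuous, i.e., continuous from P with its Lawson topology to [0,1] with its Lawson topology. -/
open Set

/-- The upper set `↑A` generated by a subset `A` of a preordered set. -/
def upSet {P : Type*} [Preorder P] (A : Set P) : Set P := {y | ∃ a ∈ A, a ≤ y}

/-- The lower set `↓A` generated by a subset `A` of a preordered set. -/
def downSet {P : Type*} [Preorder P] (A : Set P) : Set P := {y | ∃ a ∈ A, y ≤ a}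

/-- A poset is a dcpo if every (nonempty) directed subset has a least upper bound. -/
def IsDcpo (P : Type*) [Preorder P] : Prop :=
  ∀ D : Set P, D.Nonempty → DirectedOn (· ≤ ·) D → ∃ s, IsLUB D s

/-- A subset `U` is Scott open if it is an upper set and every directed set whose
supremum lies in `U` meets `U`. -/
def ScottOpen {P : Type*} [Preorder P] (U : Set P) : Prop :=
  IsUpperSet U ∧ ∀ D : Set P, ∀ s : P, D.Nonempty → DirectedOn (· ≤ ·) D →
    IsLUB D s → s ∈ U → (D ∩ U).Nonempty

/-- The Scott topology `σ(P)`. -/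
def scottT (P : Type*) [Preorder P] : TopologicalSpace P where
  IsOpen := ScottOpen
  isOpen_univ := ⟨isUpperSet_univ, fun D _ hD _ _ _ => hD.imp fun _ hd => ⟨hd, trivial⟩⟩
  isOpen_inter := by
    rintro U V ⟨hU, hU'⟩ ⟨hV, hV'⟩
    refine ⟨hU.inter hV, fun D s hD hdir hlub hs => ?_⟩
    obtain ⟨d₁, hd₁D, hd₁U⟩ := hU' D s hD hdir hlub hs.1
    obtain ⟨d₂, hd₂D, hd₂V⟩ := hV' D s hD hdir hlub hs.2
    obtain ⟨d, hdD, h₁, h₂⟩ := hdir d₁ hd₁D d₂ hd₂D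
    exact ⟨d, hdD, hU h₁ hd₁U, hV h₂ hd₂V⟩
  isOpen_sUnion := by
    intro S hS
    refine ⟨isUpperSet_sUnion fun U hU => (hS U hU).1, fun D s hD hdir hlub hs => ?_⟩
    obtain ⟨U, hUS, hsU⟩ := hs
    obtain ⟨d, hdD, hdU⟩ := (hS U hUS).2 D s hD hdir hlub hsU
    exact ⟨d, hdD, U, hUS, hdU⟩

/-- Scott interior. -/
def scottInt (P : Type*) [Preorder P] (A : Set P) : Set P := @interior P (scottT P) A

/-- Scott closure. -/
def scottCl (P : Type*) [Preorder P] (A : Set P) : Set P := @closure P (scottT P) A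

/-- The lower topology `ω(P)`, generated by the complements of principal upper sets. -/
def lowerT (P : Type*) [Preorder P] : TopologicalSpace P :=
  .generateFrom {V | ∃ x : P, V = (Ici x)ᶜ}

/-- The upper topology `υ(P)`, generated by the complements of principal lower sets. -/
def upperT (P : Type*) [Preorder P] : TopologicalSpace P :=
  .generateFrom {V | ∃ x : P, V = (Iic x)ᶜ}

/-- The Lawson topology `λ(P)`, generated by `σ(P) ∪ ω(P)`. -/
def lawsonT (P : Type*) [Preorder P] : TopologicalSpace P :=
  .generateFrom ({U | ScottOpen U} ∪ {V | ∃ x : P, V = (Ici x)ᶜ})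

/-- The interval topology `θ(P)`, generated by `ω(P) ∪ υ(P)`. -/
def intervalT (P : Type*) [Preorder P] : TopologicalSpace P :=
  .generateFrom ({V | ∃ x : P, V = (Ici x)ᶜ} ∪ {V | ∃ x : P, V = (Iic x)ᶜ})

/-- `A ≪ B`: for every directed set `D` with `sup D ∈ ↑B`, `D` meets `↑A`. -/
def WayBelowSet {P : Type*} [Preorder P] (A B : Set P) : Prop :=
  ∀ D : Set P, ∀ s : P, D.Nonempty → DirectedOn (· ≤ ·) D → IsLUB D s →
    s ∈ upSet B → (D ∩ upSet A).Nonempty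

/-- `u ≪ x`: every directed set `D` with `sup D ≥ x` contains some `d ≥ u`. -/
def WayBelowPt {P : Type*} [Preorder P] (u x : P) : Prop :=
  ∀ D : Set P, ∀ s : P, D.Nonempty → DirectedOn (· ≤ ·) D → IsLUB D s →
    x ≤ s → ∃ d ∈ D, u ≤ d

/-- A family of sets is filtered if it is (nonempty and) directed under reverse inclusion. -/
def Filtered {P : Type*} (𝒜 : Set (Set P)) : Prop :=
  𝒜.Nonempty ∧ ∀ S ∈ 𝒜, ∀ T ∈ 𝒜, ∃ R ∈ 𝒜, R ⊆ S ∧ R ⊆ T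

/-- The family `{↑F : F nonempty finite, F ≪ x}`. -/
def finWayFamily {P : Type*} [Preorder P] (x : P) : Set (Set P) :=
  {S | ∃ F : Set P, F.Nonempty ∧ F.Finite ∧ WayBelowSet F {x} ∧ S = upSet F}

/-- A quasicontinuous domain. -/
def IsQuasicontinuousDomain (P : Type*) [Preorder P] : Prop :=
  ∀ x : P, Filtered (finWayFamily x) ∧ Ici x = ⋂₀ finWayFamily x

/-- The family `{↑F : F nonempty finite, x ∈ ↑F, F ≪ F}`. -/
def finCompactFamily {P : Type*} [Preorder P] (x : P) : Set (Set P) :=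
  {S | ∃ F : Set P, F.Nonempty ∧ F.Finite ∧ x ∈ upSet F ∧ WayBelowSet F F ∧ S = upSet F}

/-- A quasialgebraic domain. -/
def IsQuasialgebraicDomain (P : Type*) [Preorder P] : Prop :=
  ∀ x : P, Filtered (finCompactFamily x) ∧ Ici x = ⋂₀ finCompactFamily x

/-- A continuous domain: every `⇓x` is directed (hence nonempty) with supremum `x`. -/
def IsContinuousDomain (P : Type*) [Preorder P] : Prop :=
  ∀ x : P, {u | WayBelowPt u x}.Nonempty ∧ DirectedOn (· ≤ ·) {u | WayBelowPt u x} ∧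
    IsLUB {u | WayBelowPt u x} x

/-- The set `K(P)` of compact elements. -/
def compacts (P : Type*) [Preorder P] : Set P := {k | WayBelowPt k k}

/-- An algebraic domain. -/
def IsAlgebraicDomain (P : Type*) [Preorder P] : Prop :=
  ∀ x : P, (compacts P ∩ Iic x).Nonempty ∧ DirectedOn (· ≤ ·) (compacts P ∩ Iic x) ∧
    IsLUB (compacts P ∩ Iic x) x

/-- A meet-continuous dcpo: whenever `x ≤ sup D` for a directed set `D`,
`x` lies in the Scott closure of `↓x ∩ ↓D`. -/
def MeetContinuous (P : Type*) [Preorder P] : Prop :=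
  ∀ x : P, ∀ D : Set P, ∀ s : P, D.Nonempty → DirectedOn (· ≤ ·) D → IsLUB D s → x ≤ s →
    x ∈ scottCl P (Iic x ∩ downSet D)

/-- The set of dyadic rationals in `[0,1]`. -/
def dyadics : Set ℝ := {t | ∃ m n : ℕ, m ≤ 2 ^ n ∧ t = (m : ℝ) / 2 ^ n}

section WayBelow

variable {P : Type*} [PartialOrder P]

/-- The upper sets `↑F` generated by nonempty finite sets `F`. -/
def IsFinUpper (S : Set P) : Prop := ∃ F : Set P, F.Nonempty ∧ F.Finite ∧ S = upSet F

/-- The set of points that a set `S` is way below. -/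
def wayAbove (S : Set P) : Set P := {y | WayBelowSet S {y}}

theorem isUpperSet_upSet (A : Set P) : IsUpperSet (upSet A) :=
  fun _ _ hab ⟨c, hc, hca⟩ => ⟨c, hc, hca.trans hab⟩

theorem upSet_eq_self {S : Set P} (hS : IsUpperSet S) : upSet S = S :=
  Subset.antisymm (fun _ ⟨_, ha, hab⟩ => hS hab ha) fun a ha => ⟨a, ha, le_rfl⟩

theorem upSet_upSet (A : Set P) : upSet (upSet A) = upSet A :=
  upSet_eq_self (isUpperSet_upSet A)

theorem IsFinUpper.isUpperSet {S : Set P} (hS : IsFinUpper S) : IsUpperSet S := by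
  obtain ⟨F, -, -, rfl⟩ := hS
  exact isUpperSet_upSet F

theorem wayBelowSet_iff {A B : Set P} : WayBelowSet A B ↔ B ⊆ wayAbove A := by
  constructor
  · rintro h b hb D s hD hdir hs ⟨a, rfl, has⟩
    exact h D s hD hdir hs ⟨a, hb, has⟩
  · rintro h D s hD hdir hs ⟨b, hb, hbs⟩
    exact h hb D s hD hdir hs ⟨b, rfl, hbs⟩

theorem wayAbove_upSet (A : Set P) : wayAbove (upSet A) = wayAbove A := by
  simp only [wayAbove, WayBelowSet, upSet_upSet]

theorem isUpperSet_wayAbove (A : Set P) : IsUpperSet (wayAbove A) := by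
  rintro a b hab ha D s hD hdir hs ⟨c, rfl, hbs⟩
  exact ha D s hD hdir hs ⟨a, rfl, hab.trans hbs⟩

theorem wayAbove_mono {A B : Set P} (h : A ⊆ upSet B) : wayAbove A ⊆ wayAbove B := by
  intro y hy D s hD hdir hs hys
  obtain ⟨d, hdD, a, ha, had⟩ := hy D s hD hdir hs hys
  exact ⟨d, hdD, isUpperSet_upSet B had (h ha)⟩

theorem wayAbove_subset {S : Set P} (hS : IsUpperSet S) : wayAbove S ⊆ S := by
  intro y hy
  obtain ⟨d, hd, hd'⟩ := hy {y} y (singleton_nonempty y) (directedOn_singleton y)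
    isLUB_singleton ⟨y, rfl, le_rfl⟩
  rw [upSet_eq_self hS] at hd'
  exact hd ▸ hd'

theorem IsFinUpper.nonempty_sInter_inter {S : Set P} (hS : IsFinUpper S) {c : Set (Set P)}
    (hc : IsChain (· ⊆ ·) c) (hne : c.Nonempty) (hlow : ∀ A ∈ c, IsLowerSet A)
    (hmeet : ∀ A ∈ c, (A ∩ S).Nonempty) : (⋂₀ c ∩ S).Nonempty := by
  obtain ⟨F, hF, hfin, rfl⟩ := hS
  by_contra hcon
  have key : ∀ a : F, ∃ A : c, (a : P) ∉ (A : Set P) := by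
    rintro ⟨a, ha⟩
    by_contra! h
    exact hcon ⟨a, fun A hA => h ⟨A, hA⟩, a, ha, le_rfl⟩
  choose g hg using key
  have := hfin.to_subtype
  have := hne.to_subtype
  have hdir : Directed (fun A B : Set P => B ⊆ A) (Subtype.val : c → Set P) := by
    intro A B
    rcases hc.total A.2 B.2 with h | h
    · exact ⟨A, Subset.rfl, h⟩
    · exact ⟨B, h, Subset.rfl⟩
  have : IsTrans (Set P) (fun A B : Set P => B ⊆ A) := ⟨fun _ _ _ h h' => h'.trans h⟩
  obtain ⟨A, hA⟩ := hdir.finite_le g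
  obtain ⟨y, hyA, a, ha, hay⟩ := hmeet A A.2
  exact hg ⟨a, ha⟩ (hA ⟨a, ha⟩ (hlow A A.2 hay hyA))

/-- Rudin's lemma, for a filtered family of finitely generated upper sets. -/
theorem exists_directed_meeting {𝓖 : Set (Set P)} (hfil : Filtered 𝓖)
    (hfin : ∀ S ∈ 𝓖, IsFinUpper S) {U : Set P} (hU : IsUpperSet U) (hno : ∀ S ∈ 𝓖, ¬ S ⊆ U) :
    ∃ A : Set P, A.Nonempty ∧ DirectedOn (· ≤ ·) A ∧ Disjoint A U ∧
      ∀ S ∈ 𝓖, (A ∩ S).Nonempty := by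
  obtain ⟨A, hAU, ⟨hAlow, hAmeet⟩, hmin⟩ := zorn_superset_nonempty
    {A : Set P | IsLowerSet A ∧ ∀ S ∈ 𝓖, (A ∩ S).Nonempty}
    (fun c hcS hc hne => ⟨⋂₀ c,
      ⟨isLowerSet_sInter fun A hA => (hcS hA).1, fun S hS =>
        (hfin S hS).nonempty_sInter_inter hc hne (fun A hA => (hcS hA).1)
          fun A hA => (hcS hA).2 S hS⟩,
      fun A hA => sInter_subset_of_mem hA⟩)
    Uᶜ ⟨hU.compl, fun S hS => by
      obtain ⟨y, hyS, hyU⟩ := not_subset.1 (hno S hS)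
      exact ⟨y, hyU, hyS⟩⟩
  have key : ∀ x ∈ A, ∃ S ∈ 𝓖, ∀ y ∈ A ∩ S, x ≤ y := by
    intro x hx
    by_contra! h
    have hmem : A \ Ici x ∈ {A : Set P | IsLowerSet A ∧ ∀ S ∈ 𝓖, (A ∩ S).Nonempty} := by
      refine ⟨hAlow.inter (isUpperSet_Ici x).compl, fun S hS => ?_⟩
      obtain ⟨y, hy, hxy⟩ := h S hS
      exact ⟨y, ⟨hy.1, hxy⟩, hy.2⟩
    exact (hmin hmem sdiff_subset hx).2 le_rfl
  refine ⟨A, ?_, ?_, disjoint_left.2 fun y hy => hAU hy, hAmeet⟩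
  · obtain ⟨S, hS⟩ := hfil.1
    exact (hAmeet S hS).mono inter_subset_left
  · intro x hx y hy
    obtain ⟨S, hS, hxS⟩ := key x hx
    obtain ⟨T, hT, hyT⟩ := key y hy
    obtain ⟨R, hR, hRS, hRT⟩ := hfil.2 S hS T hT
    obtain ⟨z, hzA, hzR⟩ := hAmeet R hR
    exact ⟨z, hzA, hxS z ⟨hzA, hRS hzR⟩, hyT z ⟨hzA, hRT hzR⟩⟩

theorem exists_subset_of_sInter_subset_wayAbove (hdcpo : IsDcpo P) {𝓖 : Set (Set P)}
    (hfil : Filtered 𝓖) (hfin : ∀ S ∈ 𝓖, IsFinUpper S) {U : Set P} (hU : IsUpperSet U)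
    (h : ⋂₀ 𝓖 ⊆ wayAbove U) : ∃ S ∈ 𝓖, S ⊆ U := by
  by_contra! hno
  obtain ⟨A, hA, hdir, hdisj, hmeet⟩ := exists_directed_meeting hfil hfin hU hno
  obtain ⟨s, hs⟩ := hdcpo A hA hdir
  have hsG : s ∈ ⋂₀ 𝓖 := fun S hS => by
    obtain ⟨y, hyA, hyS⟩ := hmeet S hS
    exact (hfin S hS).isUpperSet (hs.1 hyA) hyS
  obtain ⟨d, hdA, hdU⟩ := h hsG A s hA hdir hs ⟨s, rfl, le_rfl⟩
  exact disjoint_left.1 hdisj hdA (upSet_eq_self hU ▸ hdU)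

theorem ScottOpen.subset_wayAbove {U : Set P} (hU : ScottOpen U) : U ⊆ wayAbove U := by
  rintro x hx D s hD hdir hs ⟨y, rfl, hys⟩
  rw [upSet_eq_self hU.1]
  exact hU.2 D s hD hdir hs (hU.1 hys hx)

theorem mem_finWayFamily {x : P} {S : Set P} :
    S ∈ finWayFamily x ↔ IsFinUpper S ∧ x ∈ wayAbove S := by
  constructor
  · rintro ⟨F, hF, hfin, hFx, rfl⟩
    exact ⟨⟨F, hF, hfin, rfl⟩, by rwa [wayAbove_upSet]⟩
  · rintro ⟨⟨F, hF, hfin, rfl⟩, hx⟩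
    rw [wayAbove_upSet] at hx
    exact ⟨F, hF, hfin, hx, rfl⟩

theorem mem_finCompactFamily {x : P} {S : Set P} :
    S ∈ finCompactFamily x ↔ IsFinUpper S ∧ x ∈ S ∧ S ⊆ wayAbove S := by
  constructor
  · rintro ⟨F, hF, hfin, hFx, hFF, rfl⟩
    refine ⟨⟨F, hF, hfin, rfl⟩, hFx, ?_⟩
    rintro y ⟨a, ha, hay⟩
    rw [wayAbove_upSet]
    exact isUpperSet_wayAbove F hay (wayBelowSet_iff.1 hFF ha)
  · rintro ⟨⟨F, hF, hfin, rfl⟩, hx, hS⟩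
    rw [wayAbove_upSet] at hS
    exact ⟨F, hF, hfin, hx, wayBelowSet_iff.2 fun a ha => hS ⟨a, ha, le_rfl⟩, rfl⟩

theorem scottOpen_wayAbove (hdcpo : IsDcpo P) (hqc : IsQuasicontinuousDomain P) {U : Set P}
    (hU : IsUpperSet U) : ScottOpen (wayAbove U) := by
  refine ⟨isUpperSet_wayAbove U, fun D s hD hdir hs hsU => ?_⟩
  suffices ∃ S ∈ {S | ∃ d ∈ D, S ∈ finWayFamily d}, S ⊆ U by
    obtain ⟨S, hS, hSU⟩ := this
    obtain ⟨d, hd, hSd⟩ := hS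
    refine ⟨d, hd, wayAbove_mono ?_ (mem_finWayFamily.1 hSd).2⟩
    rwa [upSet_eq_self hU]
  refine exists_subset_of_sInter_subset_wayAbove hdcpo ?_ ?_ hU ?_
  · constructor
    · obtain ⟨d, hd⟩ := hD
      obtain ⟨S, hS⟩ := (hqc d).1.1
      exact ⟨S, d, hd, hS⟩
    · rintro S ⟨d, hd, hS⟩ T ⟨e, he, hT⟩
      obtain ⟨c, hc, hdc, hec⟩ := hdir d hd e he
      rw [mem_finWayFamily] at hS hT
      obtain ⟨R, hR, hRS, hRT⟩ := (hqc c).1.2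
        S (mem_finWayFamily.2 ⟨hS.1, isUpperSet_wayAbove S hdc hS.2⟩)
        T (mem_finWayFamily.2 ⟨hT.1, isUpperSet_wayAbove T hec hT.2⟩)
      exact ⟨R, ⟨c, hc, hR⟩, hRS, hRT⟩
  · rintro S ⟨d, -, hS⟩
    exact (mem_finWayFamily.1 hS).1
  · intro y hy
    refine isUpperSet_wayAbove U (hs.2 fun d hd => ?_) hsU
    have : y ∈ ⋂₀ finWayFamily d := fun S hS => hy S ⟨d, hd, hS⟩
    rwa [← (hqc d).2] at this

theorem ScottOpen.exists_isFinUpper_subset (hdcpo : IsDcpo P) (hqc : IsQuasicontinuousDomain P)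
    {U : Set P} (hU : ScottOpen U) {x : P} (hx : x ∈ U) :
    ∃ S, IsFinUpper S ∧ x ∈ wayAbove S ∧ S ⊆ U := by
  obtain ⟨S, hS, hSU⟩ := exists_subset_of_sInter_subset_wayAbove hdcpo (hqc x).1
    (fun S hS => (mem_finWayFamily.1 hS).1) hU.1 (by
      rw [← (hqc x).2]
      exact fun y hy => hU.subset_wayAbove (hU.1 hy hx))
  exact ⟨S, (mem_finWayFamily.1 hS).1, (mem_finWayFamily.1 hS).2, hSU⟩

theorem IsFinUpper.exists_between (hdcpo : IsDcpo P) (hqc : IsQuasicontinuousDomain P)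
    {S T : Set P} (hS : IsUpperSet S) (hT : IsFinUpper T) (h : T ⊆ wayAbove S) :
    ∃ R, IsFinUpper R ∧ R ⊆ wayAbove S ∧ T ⊆ wayAbove R := by
  obtain ⟨F, ⟨a₀, ha₀⟩, hfin, rfl⟩ := hT
  have key : ∀ a : F, ∃ H : Set P, H.Nonempty ∧ H.Finite ∧ (a : P) ∈ wayAbove H ∧
      upSet H ⊆ wayAbove S := by
    rintro ⟨a, ha⟩
    obtain ⟨_, ⟨H, hH, hHfin, rfl⟩, haR, hRS⟩ :=
      (scottOpen_wayAbove hdcpo hqc hS).exists_isFinUpper_subset hdcpo hqc (h ⟨a, ha, le_rfl⟩)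
    exact ⟨H, hH, hHfin, by rwa [wayAbove_upSet] at haR, hRS⟩
  choose H hH hHfin haH hHS using key
  have := hfin.to_subtype
  refine ⟨upSet (⋃ a, H a), ⟨_, ?_, finite_iUnion hHfin, rfl⟩, ?_, ?_⟩
  · exact (hH ⟨a₀, ha₀⟩).mono (subset_iUnion H _)
  · rintro y ⟨b, hb, hby⟩
    obtain ⟨a, hba⟩ := mem_iUnion.1 hb
    exact hHS a ⟨b, hba, hby⟩
  · rintro y ⟨a, ha, hay⟩
    rw [wayAbove_upSet]
    refine isUpperSet_wayAbove _ hay (wayAbove_mono (fun b hb => ?_) (haH ⟨a, ha⟩))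
    exact ⟨b, mem_iUnion.2 ⟨_, hb⟩, le_rfl⟩

theorem exists_no_compact_between (hqc : IsQuasicontinuousDomain P)
    (hnqa : ¬ IsQuasialgebraicDomain P) :
    ∃ (x : P) (S : Set P), IsFinUpper S ∧ x ∈ wayAbove S ∧
      ∀ T, IsFinUpper T → x ∈ T → T ⊆ S → ¬ T ⊆ wayAbove T := by
  by_contra! hcon
  refine hnqa fun x => ?_
  have key : ∀ S ∈ finWayFamily x, ∃ T ∈ finCompactFamily x, T ⊆ S := by
    intro S hS
    rw [mem_finWayFamily] at hS
    obtain ⟨T, hT, hxT, hTS, hTT⟩ := hcon x S hS.1 hS.2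
    exact ⟨T, mem_finCompactFamily.2 ⟨hT, hxT, hTT⟩, hTS⟩
  have hsub : finCompactFamily x ⊆ finWayFamily x := fun S hS => by
    rw [mem_finCompactFamily] at hS
    exact mem_finWayFamily.2 ⟨hS.1, hS.2.2 hS.2.1⟩
  refine ⟨⟨?_, fun S hS T hT => ?_⟩, Subset.antisymm ?_ ?_⟩
  · obtain ⟨S, hS⟩ := (hqc x).1.1
    obtain ⟨T, hT, -⟩ := key S hS
    exact ⟨T, hT⟩
  · obtain ⟨R, hR, hRS, hRT⟩ := (hqc x).1.2 S (hsub hS) T (hsub hT)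
    obtain ⟨Q, hQ, hQR⟩ := key R hR
    exact ⟨Q, hQ, hQR.trans hRS, hQR.trans hRT⟩
  · rw [(hqc x).2]
    exact sInter_subset_sInter hsub
  · rw [(hqc x).2]
    intro y hy S hS
    obtain ⟨T, hT, hTS⟩ := key S hS
    exact hTS (hy T hT)

theorem IsFinUpper.isOpen_compl {S : Set P} (hS : IsFinUpper S) : @IsOpen P (lawsonT P) Sᶜ := by
  obtain ⟨F, -, hfin, rfl⟩ := hS
  let := lawsonT P
  have : (upSet F)ᶜ = ⋂ a ∈ F, (Ici a)ᶜ := by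
    ext y; simp [upSet]
  rw [this]
  exact hfin.isOpen_biInter fun a _ => .basic _ (.inr ⟨a, rfl⟩)

end WayBelow

/-- A dense strict order with two related elements contains a copy of the rationals. -/
theorem exists_rat_strictMono_of_dense {α : Type*} (r : α → α → Prop) [IsStrictOrder α r]
    (hr : ∀ a b, r a b → ∃ c, r a c ∧ r c b) {a b : α} (hab : r a b) :
    ∃ F : ℚ → α, ∀ p q, p < q → r (F p) (F q) := by
  classical
  let := partialOrderOfSO r
  replace hab : a < b := hab
  obtain ⟨c, ha, hb⟩ := Flag.exists_mem_mem hab.le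
  have hdense : DenselyOrdered c := by
    refine ⟨fun p q hpq => ?_⟩
    by_contra! hno
    obtain ⟨z, hpz, hzq⟩ : ∃ z, (p : α) < z ∧ z < (q : α) := hr p q hpq
    have hz : z ∈ c := Flag.mem_iff_forall_le_or_ge.2 fun w hw => by
      rcases le_or_gt (⟨w, hw⟩ : c) p with h | h
      · exact .inr (le_trans (show w ≤ p from h) hpz.le)
      · exact .inl (hzq.le.trans (show (q : α) ≤ w from hno ⟨w, hw⟩ h))
    exact (show (q : α) ≤ z from hno ⟨z, hz⟩ hpz).not_gt hzq
  have : Nontrivial c := ⟨⟨a, ha⟩, ⟨b, hb⟩, fun h => hab.ne (congrArg Subtype.val h)⟩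
  obtain ⟨e⟩ := Order.embedding_from_countable_to_dense ℚ c
  exact ⟨fun q => e q, fun p q hpq => (e.strictMono hpq : e p < e q)⟩

theorem exists_rat_family {P : Type*} [PartialOrder P] (hdcpo : IsDcpo P)
    (hqc : IsQuasicontinuousDomain P) {x : P} {S : Set P} (hS : IsFinUpper S)
    (hx : x ∈ wayAbove S)
    (hno : ∀ T, IsFinUpper T → x ∈ T → T ⊆ S → ¬ T ⊆ wayAbove T) :
    ∃ F : ℚ → Set P, (∀ q, IsFinUpper (F q) ∧ x ∈ F q ∧ F q ⊆ S) ∧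
      ∀ p q, p < q → F q ⊆ wayAbove (F p) := by
  let α := {T : Set P // IsFinUpper T ∧ x ∈ wayAbove T ∧ T ⊆ S}
  let r : α → α → Prop := fun A B => B.1 ⊆ wayAbove A.1
  have : IsStrictOrder α r :=
    { irrefl := fun A h =>
        hno A.1 A.2.1 (wayAbove_subset A.2.1.isUpperSet A.2.2.1) A.2.2.2 h
      trans := fun A B C hAB hBC =>
        (hBC.trans (wayAbove_subset B.2.1.isUpperSet)).trans hAB }
  have hr : ∀ A B : α, r A B → ∃ C, r A C ∧ r C B := fun A B hAB => by
    obtain ⟨R, hR, hRA, hBR⟩ := B.2.1.exists_between hdcpo hqc A.2.1.isUpperSet hAB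
    exact ⟨⟨R, hR, hBR (wayAbove_subset B.2.1.isUpperSet B.2.2.1),
      (hRA.trans (wayAbove_subset A.2.1.isUpperSet)).trans A.2.2.2⟩, hRA, hBR⟩
  obtain ⟨T, hT, hxT, hTS⟩ :=
    (scottOpen_wayAbove hdcpo hqc hS.isUpperSet).exists_isFinUpper_subset hdcpo hqc hx
  have hST : r ⟨S, hS, hx, Subset.rfl⟩
      ⟨T, hT, hxT, hTS.trans (wayAbove_subset hS.isUpperSet)⟩ := hTS
  obtain ⟨F, hF⟩ := exists_rat_strictMono_of_dense r hr hST
  exact ⟨fun q => (F q).1, fun q => ⟨(F q).2.1,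
    wayAbove_subset (F q).2.1.isUpperSet (F q).2.2.1, (F q).2.2.2⟩, hF⟩

/-- Every quasicontinuous domain that fails to be quasialgebraic admits a
surjective monotone Lawson-continuous map onto the unit interval `[0,1]`
(whose Lawson topology is the standard Euclidean topology). -/
theorem quasicontinuous_not_quasialgebraic_maps_onto_unitInterval
    (P : Type*) [PartialOrder P] (hdcpo : IsDcpo P)
    (hqc : IsQuasicontinuousDomain P) (hnqa : ¬ IsQuasialgebraicDomain P) :
    ∃ f : P → Set.Icc (0 : ℝ) 1,
      Function.Surjective f ∧ Monotone f ∧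
        @Continuous P (Set.Icc (0 : ℝ) 1) (lawsonT P) inferInstance f := by
  obtain ⟨x, S, hS, hxS, hno⟩ := exists_no_compact_between hqc hnqa
  obtain ⟨F, hF, hFlt⟩ := exists_rat_family hdcpo hqc hS hxS hno
  have hanti : ∀ p q, p < q → F q ⊆ F p := fun p q h =>
    (hFlt p q h).trans (wayAbove_subset (hF p).1.isUpperSet)
  let V : P → Set ℝ := fun y => insert 0 {t | ∃ q : ℚ, 0 < q ∧ q < 1 ∧ y ∈ F q ∧ (q : ℝ) = t}
  have hVle : ∀ y, ∀ t ∈ V y, t ≤ 1 := by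
    rintro y t (rfl | ⟨q, -, hq, -, rfl⟩)
    · exact zero_le_one
    · exact_mod_cast hq.le
  have hVbdd : ∀ y, BddAbove (V y) := fun y => ⟨1, hVle y⟩
  have hVne : ∀ y, (V y).Nonempty := fun y => ⟨0, mem_insert _ _⟩
  let g : P → ℝ := fun y => sSup (V y)
  have hg0 : ∀ y, 0 ≤ g y := fun y => le_csSup (hVbdd y) (mem_insert _ _)
  have hg1 : ∀ y, g y ≤ 1 := fun y => csSup_le (hVne y) (hVle y)
  have hlt : ∀ y t, 0 ≤ t → (t < g y ↔ ∃ q : ℚ, 0 < q ∧ q < 1 ∧ t < q ∧ y ∈ F q) := by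
    intro y t ht
    rw [lt_csSup_iff (hVbdd y) (hVne y)]
    constructor
    · rintro ⟨_, rfl | ⟨q, h0, h1, hy, rfl⟩, htq⟩
      · exact absurd htq ht.not_gt
      · exact ⟨q, h0, h1, htq, hy⟩
    · rintro ⟨q, h0, h1, htq, hy⟩
      exact ⟨q, .inr ⟨q, h0, h1, hy, rfl⟩, htq⟩
  have hmem : ∀ y (q : ℚ), 0 < q → (q : ℝ) < g y → y ∈ F q := by
    intro y q hq hqy
    obtain ⟨p, -, -, hqp, hy⟩ := (hlt y q (by exact_mod_cast hq.le)).1 hqy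
    exact hanti q p (by exact_mod_cast hqp) hy
  have hmono : Monotone g := by
    intro y z hyz
    by_contra! h
    obtain ⟨q, h0, h1, hq, hy⟩ := (hlt y _ (hg0 z)).1 h
    exact hq.not_ge (le_csSup (hVbdd z)
      (.inr ⟨q, h0, h1, (hF q).1.isUpperSet hyz hy, rfl⟩))
  have hscott : ∀ t, 0 ≤ t → ScottOpen {y | t < g y} := by
    refine fun t ht => ⟨fun y z hyz hy => lt_of_lt_of_le hy (hmono hyz),
      fun D s hD hdir hs hts => ?_⟩
    obtain ⟨q, h0, h1, hq, hsq⟩ := (hlt s t ht).1 hts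
    obtain ⟨p, htp, hpq⟩ := exists_rat_btwn hq
    have hpq : p < q := by exact_mod_cast hpq
    obtain ⟨d, hdD, hdp⟩ := hFlt p q hpq hsq D s hD hdir hs ⟨s, rfl, le_rfl⟩
    rw [upSet_eq_self (hF p).1.isUpperSet] at hdp
    exact ⟨d, hdD, (hlt d t ht).2
      ⟨p, by exact_mod_cast ht.trans_lt htp, hpq.trans h1, htp, hdp⟩⟩
  refine ⟨fun y => ⟨g y, hg0 y, hg1 y⟩, ?_, fun y z hyz => hmono hyz, ?_⟩
  · rintro ⟨t, ht0, ht1⟩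
    suffices ∃ y, g y = t from this.imp fun y hy => Subtype.ext hy
    by_contra! hne
    have ht0' : 0 < t := by
      refine ht0.lt_of_ne ?_
      rintro rfl
      have hSne : ∃ y, y ∉ S := by
        by_contra! hall
        refine hno S hS (hall x) Subset.rfl fun y _ D s hD hdir hs _ => ?_
        obtain ⟨d, hd⟩ := hD
        exact ⟨d, hd, d, hall d, le_rfl⟩
      obtain ⟨y, hy⟩ := hSne
      obtain ⟨q, -, -, -, hyq⟩ := (hlt y 0 le_rfl).1 ((hg0 y).lt_of_ne' (hne y))
      exact hy ((hF q).2.2 hyq)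
    have ht1' : t < 1 := by
      refine ht1.lt_of_ne ?_
      rintro rfl
      obtain ⟨q, hxq, hq⟩ := exists_rat_btwn ((hg1 x).lt_of_ne (hne x))
      exact hxq.not_ge (le_csSup (hVbdd x) (.inr ⟨q, by exact_mod_cast (hg0 x).trans_lt hxq,
        by exact_mod_cast hq, (hF q).2.1, rfl⟩))
    suffices ∃ T ∈ {T | ∃ q : ℚ, 0 < q ∧ (q : ℝ) < t ∧ F q = T}, T ⊆ {y | t < g y} by
      obtain ⟨_, ⟨q, h0, hqt, rfl⟩, hsub⟩ := this
      refine hno (F q) (hF q).1 (hF q).2.1 (hF q).2.2 fun y hy => ?_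
      obtain ⟨p, -, -, htp, hyp⟩ := (hlt y t ht0).1 (hsub hy)
      exact hFlt q p (by exact_mod_cast hqt.trans htp) hyp
    refine exists_subset_of_sInter_subset_wayAbove hdcpo ?_ ?_ (hscott t ht0).1 ?_
    · constructor
      · obtain ⟨q, h0, hqt⟩ := exists_rat_btwn ht0'
        exact ⟨_, q, by exact_mod_cast h0, hqt, rfl⟩
      · rintro _ ⟨p, hp0, hpt, rfl⟩ _ ⟨q, hq0, hqt, rfl⟩
        rcases lt_trichotomy p q with h | rfl | h
        · exact ⟨_, ⟨q, hq0, hqt, rfl⟩, hanti p q h, Subset.rfl⟩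
        · exact ⟨_, ⟨p, hq0, hqt, rfl⟩, Subset.rfl, Subset.rfl⟩
        · exact ⟨_, ⟨p, hp0, hpt, rfl⟩, Subset.rfl, hanti q p h⟩
    · rintro _ ⟨q, -, -, rfl⟩
      exact (hF q).1
    · intro y hy
      refine (hscott t ht0).subset_wayAbove (lt_of_le_of_ne (le_of_not_gt fun h => ?_) (hne y).symm)
      obtain ⟨q, hyq, hqt⟩ := exists_rat_btwn h
      have h0 : 0 < q := by exact_mod_cast (hg0 y).trans_lt hyq
      exact hyq.not_ge (le_csSup (hVbdd y) (.inr ⟨q, h0, by exact_mod_cast hqt.trans ht1',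
        hy _ ⟨q, h0, hqt, rfl⟩, rfl⟩))
  · let := lawsonT P
    suffices Continuous g from this.subtype_mk _
    refine OrderTopology.continuous_iff.2 fun t => ⟨?_, ?_⟩
    · rcases lt_or_ge t 0 with ht | ht
      · convert isOpen_univ
        exact eq_univ_of_forall fun y => ht.trans_le (hg0 y)
      · exact .basic _ (.inl (hscott t ht))
    · rcases lt_or_ge 1 t with ht | ht
      · convert isOpen_univ
        exact eq_univ_of_forall fun y => (hg1 y).trans_lt ht
      · have : g ⁻¹' Iio t = ⋃ q : {q : ℚ // 0 < q ∧ (q : ℝ) < t}, (F q)ᶜ := by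
          ext y
          simp only [mem_preimage, mem_Iio, mem_iUnion, mem_compl_iff]
          constructor
          · intro h
            obtain ⟨q, hyq, hqt⟩ := exists_rat_btwn h
            have h0 : 0 < q := by exact_mod_cast (hg0 y).trans_lt hyq
            exact ⟨⟨q, h0, hqt⟩, fun hy => hyq.not_ge (le_csSup (hVbdd y)
              (.inr ⟨q, h0, by exact_mod_cast hqt.trans_le ht, hy, rfl⟩))⟩
          · rintro ⟨⟨q, h0, hqt⟩, hy⟩
            exact (le_of_not_gt fun h => hy (hmem y q h0 h)).trans_lt hqt
        rw [this]
        exact isOpen_iUnion fun q => (hF q).1.isOpen_compl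
end

section
/- Every countable continuous domain is algebraic. -/
open Set

theorem WayBelowPt.mono {P : Type*} [Preorder P] {a b u v : P} (h : WayBelowPt u v)
    (hau : a ≤ u) (hvb : v ≤ b) : WayBelowPt a b := by
  intro D s hne hD hs hbs
  obtain ⟨d, hd, hud⟩ := h D s hne hD hs (hvb.trans hbs)
  exact ⟨d, hd, hau.trans hud⟩

theorem WayBelowPt.le {P : Type*} [Preorder P] {u v : P} (h : WayBelowPt u v) : u ≤ v := by
  obtain ⟨d, rfl, hd⟩ := h {v} v (singleton_nonempty v) (directedOn_singleton v)
    isLUB_singleton le_rfl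
  exact hd

/-- The interpolation property of the way-below relation in a continuous domain. -/
theorem IsContinuousDomain.exists_between {P : Type*} [Preorder P] (hc : IsContinuousDomain P)
    {x y : P} (h : WayBelowPt x y) : ∃ z, WayBelowPt x z ∧ WayBelowPt z y := by
  have hne : {u | ∃ v, WayBelowPt u v ∧ WayBelowPt v y}.Nonempty := by
    obtain ⟨v, hv⟩ := (hc y).1
    obtain ⟨u, hu⟩ := (hc v).1
    exact ⟨u, v, hu, hv⟩
  have hdir : DirectedOn (· ≤ ·) {u | ∃ v, WayBelowPt u v ∧ WayBelowPt v y} := by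
    rintro u₁ ⟨v₁, hu₁, hv₁⟩ u₂ ⟨v₂, hu₂, hv₂⟩
    obtain ⟨v, hv, h₁, h₂⟩ := (hc y).2.1 v₁ hv₁ v₂ hv₂
    obtain ⟨u, hu, h₁, h₂⟩ := (hc v).2.1 u₁ (hu₁.mono le_rfl h₁) u₂ (hu₂.mono le_rfl h₂)
    exact ⟨u, ⟨v, hu, hv⟩, h₁, h₂⟩
  have hlub : IsLUB {u | ∃ v, WayBelowPt u v ∧ WayBelowPt v y} y := by
    refine ⟨fun u ⟨v, hu, hv⟩ => hu.le.trans hv.le, fun b hb => ?_⟩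
    exact (hc y).2.2.2 fun v hv => (hc v).2.2.2 fun u hu => hb ⟨v, hu, hv⟩
  obtain ⟨d, ⟨v, hdv, hvy⟩, hxd⟩ := h _ y hne hdir hlub le_rfl
  exact ⟨v, hdv.mono hxd le_rfl, hvy⟩

/-- In a continuous domain, an interval `[a, b]` with `a ≪ b` and without compact elements
contains a subinterval of the same kind avoiding a given point. -/
theorem IsContinuousDomain.exists_subinterval_notMem {P : Type*} [Preorder P]
    (hc : IsContinuousDomain P) {a b : P} (h : WayBelowPt a b)
    (hk : ∀ k ∈ compacts P, k ∉ Icc a b) (p : P) :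
    ∃ a' b', WayBelowPt a' b' ∧ a ≤ a' ∧ b' ≤ b ∧ p ∉ Icc a' b' := by
  obtain ⟨c, hac, hcb⟩ := hc.exists_between h
  obtain ⟨d, hcd, hdb⟩ := hc.exists_between hcb
  by_cases hdp : d ≤ p
  · exact ⟨a, c, hac, le_rfl, hcb.le, fun hp =>
      hk c (hcd.mono le_rfl (hdp.trans hp.2)) ⟨hac.le, hcb.le⟩⟩
  · exact ⟨d, b, hdb, hac.le.trans hcd.le, le_rfl, fun hp => hdp hp.1⟩

/-- In a countable continuous domain, any `x ≪ y` has a compact element in between. -/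
theorem IsContinuousDomain.exists_compact_between {P : Type*} [Preorder P] [Countable P]
    (hdcpo : IsDcpo P) (hc : IsContinuousDomain P) {x y : P} (h : WayBelowPt x y) :
    ∃ k ∈ compacts P, k ∈ Icc x y := by
  by_contra! hk
  have : Nonempty P := ⟨x⟩
  obtain ⟨e, he⟩ := exists_surjective_nat P
  let Q := {q : P × P // WayBelowPt q.1 q.2 ∧ x ≤ q.1 ∧ q.2 ≤ y}
  have step (n : ℕ) (q : Q) :
      ∃ r : Q, q.1.1 ≤ r.1.1 ∧ r.1.2 ≤ q.1.2 ∧ e n ∉ Icc r.1.1 r.1.2 := by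
    obtain ⟨⟨a, b⟩, hab, hxa, hby⟩ := q
    obtain ⟨a', b', hab', ha, hb, hn⟩ := hc.exists_subinterval_notMem hab
      (fun k hkc hkab => hk k hkc (Icc_subset_Icc hxa hby hkab)) (e n)
    exact ⟨⟨(a', b'), hab', hxa.trans ha, hb.trans hby⟩, ha, hb, hn⟩
  choose next hfst hsnd hnotMem using step
  let q : ℕ → Q := fun n => Nat.rec ⟨(x, y), h, le_rfl, le_rfl⟩ next n
  have hmono : Monotone fun n => (q n).1.1 := monotone_nat_of_le_succ fun n => hfst n (q n)
  have hanti : Antitone fun n => (q n).1.2 := antitone_nat_of_succ_le fun n => hsnd n (q n)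
  obtain ⟨z, hz⟩ := hdcpo (range fun n => (q n).1.1) (range_nonempty _)
    hmono.directed_le.directedOn_range
  obtain ⟨n, rfl⟩ := he z
  refine hnotMem n (q n) ⟨hz.1 ⟨n + 1, rfl⟩, hz.2 ?_⟩
  rintro _ ⟨m, rfl⟩
  exact (hmono (le_max_left m (n + 1))).trans
    ((q (max m (n + 1))).2.1.le.trans (hanti (le_max_right m (n + 1))))

/-- Every countable continuous domain is algebraic. -/
theorem countable_continuous_is_algebraic
    (P : Type*) [PartialOrder P] [Countable P] (hdcpo : IsDcpo P)
    (hc : IsContinuousDomain P) : IsAlgebraicDomain P := by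
  intro x
  obtain ⟨⟨u, hu⟩, hdir, hlub⟩ := hc x
  refine ⟨?_, ?_, fun k hk => hk.2, fun b hb => hlub.2 fun v hv => ?_⟩
  · obtain ⟨k, hk, hkx⟩ := hc.exists_compact_between hdcpo hu
    exact ⟨k, hk, hkx.2⟩
  · rintro k₁ ⟨hk₁, hx₁⟩ k₂ ⟨hk₂, hx₂⟩
    obtain ⟨v, hv, h₁, h₂⟩ :=
      hdir k₁ (WayBelowPt.mono hk₁ le_rfl hx₁) k₂ (WayBelowPt.mono hk₂ le_rfl hx₂)
    obtain ⟨k, hk, hvk, hkx⟩ := hc.exists_compact_between hdcpo hv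
    exact ⟨k, ⟨hk, hkx⟩, h₁.trans hvk, h₂.trans hvk⟩
  · obtain ⟨k, hk, hvk, hkx⟩ := hc.exists_compact_between hdcpo hv
    exact hvk.trans (hb ⟨hk, hkx⟩)
end

section
/- Let X be a set equipped with a transitive binary relation ⊑ satisfying the interpolation property: whenever a ⊑ c there exists b ∈ X with a ⊑ b ⊑ c. Let B = {m/2^n : m, n ∈ ℕ, m ≤ 2^n} be the set of dyadic rationals in [0,1]. If a ⊑ c in X, then there exists a family (x_b)_{b ∈ B} of elements of X such that x_1 = a, x_0 = c, and x_{b₂} ⊑ x_{b₁} whenever b₁ < b₂ in B. -/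
open Set

open Classical in
/-- An element between `p` and `q` whenever `r p q` can be interpolated. -/
noncomputable def interpolant {X : Type*} (r : X → X → Prop) (p q : X) : X :=
  if h : ∃ b, r p b ∧ r b q then h.choose else p

theorem interpolant_spec {X : Type*} {r : X → X → Prop} {p q : X}
    (h : ∃ b, r p b ∧ r b q) : r p (interpolant r p q) ∧ r (interpolant r p q) q := by
  rw [interpolant, dif_pos h]
  exact h.choose_spec

/-- The `n`-th stage of the iterated bisection of `r a c`: `dyadicStage r a c n m` is the
element attached to `m / 2 ^ n`. -/
noncomputable def dyadicStage {X : Type*} (r : X → X → Prop) (a c : X) : ℕ → ℕ → X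
  | 0, m => if m = 0 then c else a
  | n + 1, m =>
    if m % 2 = 0 then dyadicStage r a c n (m / 2)
    else interpolant r (dyadicStage r a c n (m / 2 + 1)) (dyadicStage r a c n (m / 2))

theorem dyadicStage_succ_rel {X : Type*} {r : X → X → Prop}
    (hint : ∀ a c : X, r a c → ∃ b : X, r a b ∧ r b c) {a c : X} (hac : r a c)
    (n m : ℕ) (hm : m < 2 ^ n) :
    r (dyadicStage r a c n (m + 1)) (dyadicStage r a c n m) := by
  induction n generalizing m with
  | zero =>
    obtain rfl : m = 0 := by simpa using hm
    simpa [dyadicStage] using hac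
  | succ n ih =>
    have h := interpolant_spec (hint _ _ (ih (m / 2) (by rw [pow_succ] at hm; omega)))
    rcases Nat.mod_two_eq_zero_or_one m with h0 | h1
    · rw [dyadicStage, dyadicStage, if_neg (by omega), if_pos h0,
        show (m + 1) / 2 = m / 2 by omega]
      exact h.2
    · rw [dyadicStage, dyadicStage, if_pos (by omega), if_neg (by omega),
        show (m + 1) / 2 = m / 2 + 1 by omega]
      exact h.1

theorem dyadicStage_rel_of_lt {X : Type*} {r : X → X → Prop} (htrans : Transitive r)
    (hint : ∀ a c : X, r a c → ∃ b : X, r a b ∧ r b c) {a c : X} (hac : r a c)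
    {n i j : ℕ} (hij : i < j) (hj : j ≤ 2 ^ n) :
    r (dyadicStage r a c n j) (dyadicStage r a c n i) := by
  induction j, hij using Nat.le_induction with
  | base => exact dyadicStage_succ_rel hint hac n i hj
  | succ j _ ih =>
    exact htrans (dyadicStage_succ_rel hint hac n j hj) (ih (Nat.le_of_succ_le hj))

theorem dyadicStage_add {X : Type*} (r : X → X → Prop) (a c : X) (n k m : ℕ) :
    dyadicStage r a c (n + k) (m * 2 ^ k) = dyadicStage r a c n m := by
  induction k with
  | zero => simp
  | succ k ih =>
    rw [← add_assoc, dyadicStage, pow_succ, ← mul_assoc, if_pos (by omega),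
      Nat.mul_div_cancel _ two_pos, ih]

theorem dyadicStage_congr {X : Type*} (r : X → X → Prop) (a c : X) {m n m' n' : ℕ}
    (h : (m : ℝ) / 2 ^ n = m' / 2 ^ n') :
    dyadicStage r a c n m = dyadicStage r a c n' m' := by
  rw [div_eq_div_iff (by positivity) (by positivity)] at h
  rw [← dyadicStage_add r a c n n' m, ← dyadicStage_add r a c n' n m', add_comm n' n]
  congr 1
  exact_mod_cast h

open Classical in
/-- The element attached to the dyadic rational `t` by iterated bisection (and `a` elsewhere). -/
noncomputable def dyadicFamily {X : Type*} (r : X → X → Prop) (a c : X) (t : ℝ) : X :=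
  if h : ∃ p : ℕ × ℕ, t = (p.1 : ℝ) / 2 ^ p.2 then dyadicStage r a c h.choose.2 h.choose.1 else a

theorem dyadicFamily_div {X : Type*} (r : X → X → Prop) (a c : X) (m n : ℕ) :
    dyadicFamily r a c ((m : ℝ) / 2 ^ n) = dyadicStage r a c n m := by
  have h : ∃ p : ℕ × ℕ, (m : ℝ) / 2 ^ n = (p.1 : ℝ) / 2 ^ p.2 := ⟨(m, n), rfl⟩
  rw [dyadicFamily, dif_pos h]
  exact (dyadicStage_congr r a c h.choose_spec).symm

/-- A transitive relation with the interpolation property admits, between any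
two related elements `a ⊑ c`, a family indexed by the dyadic rationals of `[0,1]` with
`x 1 = a`, `x 0 = c` and `x b₂ ⊑ x b₁` whenever `b₁ < b₂` in `B`. -/
theorem dyadic_family_of_transitive_interpolative
    (X : Type*) (r : X → X → Prop) (htrans : Transitive r)
    (hint : ∀ a c : X, r a c → ∃ b : X, r a b ∧ r b c)
    (a c : X) (hac : r a c) :
    ∃ x : ℝ → X, x 1 = a ∧ x 0 = c ∧
      ∀ b₁ ∈ dyadics, ∀ b₂ ∈ dyadics, b₁ < b₂ → r (x b₂) (x b₁) := by
  refine ⟨dyadicFamily r a c, ?_, ?_, ?_⟩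
  · simpa [dyadicStage] using dyadicFamily_div r a c 1 0
  · simpa [dyadicStage] using dyadicFamily_div r a c 0 0
  · rintro _ ⟨m, n, -, rfl⟩ _ ⟨m', n', hm', rfl⟩ hlt
    rw [div_lt_div_iff₀ (by positivity) (by positivity)] at hlt
    rw [dyadicFamily_div, dyadicFamily_div, ← dyadicStage_add r a c n n' m,
      ← dyadicStage_add r a c n' n m', add_comm n' n]
    refine dyadicStage_rel_of_lt htrans hint hac (by exact_mod_cast hlt) ?_
    rw [add_comm n n', pow_add]
    gcongr
end

section
/- (Rudin's Lemma, Jung's version.) Let P be a poset and {F_i : i ∈ I} a family of nonempty finite subsets of P such that the family {↑F_i : i ∈ I} is filtered (directed under reverse inclusion). Then there exists a directed subset D of ⋃_{i ∈ I} F_i such that D ∩ F_i ≠ ∅ for every i ∈ I. -/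
open Set

/-- If every member of a nonempty chain of sets meets a finite set, so does the intersection of
the chain. -/
lemma IsChain.sInter_inter_nonempty {α : Type*} {c : Set (Set α)} {F : Set α}
    (hc : IsChain (· ⊆ ·) c) (hcne : c.Nonempty) (hF : F.Finite)
    (h : ∀ C ∈ c, (C ∩ F).Nonempty) : (⋂₀ c ∩ F).Nonempty := by
  have hfin : ((· ∩ F) '' c).Finite :=
    hF.finite_subsets.subset (image_subset_iff.2 fun _ _ => inter_subset_right)
  obtain ⟨C, hC, hmin⟩ := hfin.exists_minimalFor' (· ∩ F) c hcne
  obtain ⟨x, hxC, hxF⟩ := h C hC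
  refine ⟨x, fun B hB => ?_, hxF⟩
  rcases hc.total hC hB with hCB | hBC
  · exact hCB hxC
  · exact (hmin hB (inter_subset_inter_left F hBC) ⟨hxC, hxF⟩).1

/-- Every family of nonempty finite sets admits a minimal lower set meeting all of its members. -/
lemma exists_minimal_isLowerSet_inter_nonempty {P : Type*} [Preorder P] {I : Type*} {F : I → Set P}
    (hne : ∀ i, (F i).Nonempty) (hfin : ∀ i, (F i).Finite) :
    ∃ L : Set P, Minimal (fun L => IsLowerSet L ∧ ∀ i, (L ∩ F i).Nonempty) L := by
  obtain ⟨L, -, hL⟩ := zorn_superset_nonempty {L : Set P | IsLowerSet L ∧ ∀ i, (L ∩ F i).Nonempty}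
    (fun c hcS hc hcne => ⟨⋂₀ c, ⟨isLowerSet_sInter fun C hC => (hcS hC).1, fun i =>
      hc.sInter_inter_nonempty hcne (hfin i) fun C hC => (hcS hC).2 i⟩,
      fun _ => sInter_subset_of_mem⟩)
    univ ⟨isLowerSet_univ, fun i => by simpa using hne i⟩
  exact ⟨L, hL⟩

/-- A point of a minimal lower set `L` meeting all `F i` is a lower bound of some `L ∩ F i`. -/
lemma Minimal.exists_inter_subset_Ici {P : Type*} [Preorder P] {I : Type*} {F : I → Set P}
    {L : Set P} (hL : Minimal (fun L => IsLowerSet L ∧ ∀ i, (L ∩ F i).Nonempty) L)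
    {x : P} (hx : x ∈ L) : ∃ i, L ∩ F i ⊆ Ici x := by
  by_contra! h
  have hlow : IsLowerSet (L \ Ici x) := hL.prop.1.inter (isUpperSet_Ici x).compl
  have hmeet : ∀ i, (L \ Ici x ∩ F i).Nonempty := fun i => by
    obtain ⟨y, ⟨hyL, hyF⟩, hy⟩ := not_subset.1 (h i)
    exact ⟨y, ⟨hyL, hy⟩, hyF⟩
  exact (hL.le_of_le ⟨hlow, hmeet⟩ sdiff_subset hx).2 le_rfl

/-- Rudin's Lemma, Jung's version: If `{↑F_i : i ∈ I}` is a filtered family of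
finitely generated upper sets, there is a directed subset of `⋃ᵢ Fᵢ` meeting every `Fᵢ`. -/
theorem rudin_lemma
    (P : Type*) [PartialOrder P] {I : Type*} (F : I → Set P)
    (hne : ∀ i, (F i).Nonempty) (hfin : ∀ i, (F i).Finite)
    (hfil : Filtered {S | ∃ i, S = upSet (F i)}) :
    ∃ D : Set P, D ⊆ ⋃ i, F i ∧ D.Nonempty ∧ DirectedOn (· ≤ ·) D ∧
      ∀ i, (D ∩ F i).Nonempty := by
  obtain ⟨L, hL⟩ := exists_minimal_isLowerSet_inter_nonempty hne hfin
  obtain ⟨hlow, hmeet⟩ := hL.prop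
  have hmeetD : ∀ i, (L ∩ (⋃ i, F i) ∩ F i).Nonempty := fun i => by
    obtain ⟨x, hxL, hxF⟩ := hmeet i
    exact ⟨x, ⟨hxL, mem_iUnion_of_mem i hxF⟩, hxF⟩
  obtain ⟨⟨_, i₀, -⟩, hdir⟩ := hfil
  refine ⟨L ∩ ⋃ i, F i, inter_subset_right, (hmeetD i₀).left, ?_, hmeetD⟩
  rintro x ⟨hxL, -⟩ y ⟨hyL, -⟩
  obtain ⟨j, hj⟩ := hL.exists_inter_subset_Ici hxL
  obtain ⟨k, hk⟩ := hL.exists_inter_subset_Ici hyL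
  obtain ⟨_, ⟨m, rfl⟩, hmj, hmk⟩ := hdir _ ⟨j, rfl⟩ _ ⟨k, rfl⟩
  obtain ⟨z, hzD, hzF⟩ := hmeetD m
  obtain ⟨a, haF, haz⟩ := hmj ⟨z, hzF, le_rfl⟩
  obtain ⟨b, hbF, hbz⟩ := hmk ⟨z, hzF, le_rfl⟩
  exact ⟨z, hzD, (hj ⟨hlow haz hzD.1, haF⟩).trans haz, (hk ⟨hlow hbz hzD.1, hbF⟩).trans hbz⟩
end

section
/- Let P be a dcpo, U a Scott open subset of P, and {↑F_i : i ∈ I} a filtered family of finitely generated upper sets of P (each F_i nonempty finite) with ⋂_{i ∈ I} ↑F_i ⊆ U. Then ↑F_i ⊆ U for some i ∈ I. -/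
open Set

/-- If every member of a chain of sets meets a nonempty finite set `F`, then so does the
intersection of the chain. -/
theorem IsChain.sInter_inter_nonempty_of_finite {α : Type*} {c : Set (Set α)} {F : Set α}
    (hc : IsChain (· ⊆ ·) c) (hF : F.Nonempty) (hfin : F.Finite)
    (h : ∀ L ∈ c, (L ∩ F).Nonempty) : (⋂₀ c ∩ F).Nonempty := by
  by_contra hcon
  have hmiss : ∀ a ∈ F, ∃ L ∈ c, a ∉ L := by
    intro a ha
    by_contra! hall
    exact hcon ⟨a, mem_sInter.2 hall, ha⟩
  choose! g hgc hg using hmiss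
  obtain ⟨a, ha, hmin⟩ := hfin.exists_minimalFor g F hF
  obtain ⟨b, hb, hbF⟩ := h (g a) (hgc a ha)
  have hab : g a ⊆ g b := (hc.total (hgc a ha) (hgc b hbF)).elim id fun hba => hmin hbF hba
  exact hg b hbF (hab hb)

/-- A form of Rudin's lemma: a lower set meeting every member of a family of nonempty finite
sets whose generated upper sets are filtered contains a directed set meeting every member. -/
theorem IsLowerSet.exists_directedOn_inter_nonempty {P : Type*} [Preorder P] {A : Set P}
    (hA : IsLowerSet A) {I : Type*} {F : I → Set P} (hfin : ∀ i, (F i).Finite)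
    (hfil : Filtered {S | ∃ i, S = upSet (F i)}) (hAF : ∀ i, (A ∩ F i).Nonempty) :
    ∃ D ⊆ A, DirectedOn (· ≤ ·) D ∧ ∀ i, (D ∩ F i).Nonempty := by
  obtain ⟨D, hDA, hD⟩ := zorn_superset_nonempty {L : Set P | IsLowerSet L ∧ ∀ i, (L ∩ F i).Nonempty}
    (fun c hcS hc _ => ⟨⋂₀ c, ⟨isLowerSet_sInter fun L hL => (hcS hL).1, fun i =>
      hc.sInter_inter_nonempty_of_finite ((hAF i).mono inter_subset_right) (hfin i)
        fun L hL => (hcS hL).2 i⟩, fun L hL => sInter_subset_of_mem hL⟩) A ⟨hA, hAF⟩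
  have hlow : IsLowerSet D := hD.prop.1
  have hbound : ∀ x ∈ D, ∃ i, ∀ z ∈ D, z ∈ F i → x ≤ z := by
    intro x hx
    by_contra! hcon
    have hmem : D \ Ici x ∈ {L : Set P | IsLowerSet L ∧ ∀ i, (L ∩ F i).Nonempty} := by
      refine ⟨fun a b hba ha => ⟨hlow hba ha.1, fun hb => ha.2 (le_trans hb hba)⟩, fun i => ?_⟩
      obtain ⟨z, hzD, hzF, hxz⟩ := hcon i
      exact ⟨z, ⟨hzD, hxz⟩, hzF⟩
    exact (hD.le_of_le hmem sdiff_subset hx).2 le_rfl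
  refine ⟨D, hDA, fun x hx y hy => ?_, hD.prop.2⟩
  obtain ⟨i, hi⟩ := hbound x hx
  obtain ⟨j, hj⟩ := hbound y hy
  obtain ⟨_, ⟨k, rfl⟩, hki, hkj⟩ := hfil.2 _ ⟨i, rfl⟩ _ ⟨j, rfl⟩
  obtain ⟨z, hzD, hzF⟩ := hD.prop.2 k
  obtain ⟨a, ha, haz⟩ := hki ⟨z, hzF, le_rfl⟩
  obtain ⟨b, hb, hbz⟩ := hkj ⟨z, hzF, le_rfl⟩
  exact ⟨z, hzD, (hi a (hlow haz hzD) ha).trans haz, (hj b (hlow hbz hzD) hb).trans hbz⟩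

/-- If a filtered family of finitely generated upper sets of a dcpo has its
intersection inside a Scott open set `U`, then some member is already inside `U`. -/
theorem filtered_inter_subset_scottOpen
    (P : Type*) [PartialOrder P] (hdcpo : IsDcpo P)
    (U : Set P) (hU : ScottOpen U)
    {I : Type*} (F : I → Set P)
    (hne : ∀ i, (F i).Nonempty) (hfin : ∀ i, (F i).Finite)
    (hfil : Filtered {S | ∃ i, S = upSet (F i)})
    (hsub : ⋂ i, upSet (F i) ⊆ U) :
    ∃ i, upSet (F i) ⊆ U := by
  by_contra! hcon
  have hmeet : ∀ i, (Uᶜ ∩ F i).Nonempty := by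
    intro i
    obtain ⟨y, ⟨a, ha, hay⟩, hy⟩ := not_subset.1 (hcon i)
    exact ⟨a, fun haU => hy (hU.1 hay haU), ha⟩
  obtain ⟨D, hDU, hdir, hDF⟩ :=
    hU.1.compl.exists_directedOn_inter_nonempty hfin hfil hmeet
  obtain ⟨_, i, -⟩ := hfil.1
  have hDne : D.Nonempty := (hDF i).mono inter_subset_left
  obtain ⟨s, hs⟩ := hdcpo D hDne hdir
  have hsU : s ∈ U := hsub <| mem_iInter.2 fun j =>
    let ⟨d, hdD, hdF⟩ := hDF j
    ⟨d, hdF, hs.1 hdD⟩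
  obtain ⟨d, hdD, hdU⟩ := hU.2 D s hDne hdir hs hsU
  exact hDU hdD hdU
end

section
/- Let P be a dcpo, let B = {m/2^n : m, n ∈ ℕ, m ≤ 2^n} be the dyadic rationals in [0,1], and for each b ∈ B let F(b) be a nonempty finite subset of P such that ↑F(b₂) ⊆ int_{σ(P)}(↑F(b₁)) whenever b₁ < b₂ in B. Define f : P → [0,1] by f(y) = sup{b ∈ B : y ∈ ↑F(b)} if y ∈ ↑F(0) and f(y) = 0 otherwise. Then for every β ∈ [0,1), f⁻¹((β,1]) = ⋃_{b ∈ B, b > β} int_{σ(P)}(↑F(b)), which is Scott open; and for every α ∈ (0,1], f⁻¹([0,α)) = (P ∖ ↑F(0)) ∪ ⋃_{b ∈ B, b < α}(P ∖ ↑F(b)), which is open in the lower topology ω(P). -/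
open Set

theorem zero_mem_dyadics : (0 : ℝ) ∈ dyadics := ⟨0, 0, by simp, by simp⟩

theorem nonneg_of_mem_dyadics {b : ℝ} (hb : b ∈ dyadics) : 0 ≤ b := by
  obtain ⟨m, n, -, rfl⟩ := hb
  positivity

theorem le_one_of_mem_dyadics {b : ℝ} (hb : b ∈ dyadics) : b ≤ 1 := by
  obtain ⟨m, n, hmn, rfl⟩ := hb
  rw [div_le_one (by positivity)]
  exact_mod_cast hmn

theorem exists_mem_dyadics_between {x y : ℝ} (hx : 0 ≤ x) (hxy : x < y) (hy : y ≤ 1) :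
    ∃ b ∈ dyadics, x < b ∧ b < y := by
  obtain ⟨n, hn⟩ := exists_pow_lt_of_lt_one (sub_pos.2 hxy) (by norm_num : (1 / 2 : ℝ) < 1)
  have hpos : (0 : ℝ) < 2 ^ n := by positivity
  have hgap : 1 < (y - x) * 2 ^ n := by
    rwa [one_div, inv_pow, inv_lt_iff_one_lt_mul₀ hpos] at hn
  have hfloor := Nat.floor_le (mul_nonneg hx hpos.le)
  have hlt := Nat.lt_floor_add_one (x * 2 ^ n)
  have hub : ((⌊x * 2 ^ n⌋₊ + 1 : ℕ) : ℝ) < y * 2 ^ n := by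
    push_cast
    linarith
  refine ⟨_, ⟨⌊x * 2 ^ n⌋₊ + 1, n, ?_, rfl⟩, ?_, ?_⟩
  · have : ((⌊x * 2 ^ n⌋₊ + 1 : ℕ) : ℝ) ≤ (2 ^ n : ℕ) := by
      push_cast at hub ⊢
      nlinarith
    exact_mod_cast this
  · rw [lt_div_iff₀ hpos]
    exact_mod_cast hlt
  · rwa [div_lt_iff₀ hpos]

theorem scottInt_subset {P : Type*} [Preorder P] (A : Set P) : scottInt P A ⊆ A :=
  @interior_subset P (scottT P) A

theorem isOpen_scottInt {P : Type*} [Preorder P] (A : Set P) :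
    @IsOpen P (scottT P) (scottInt P A) :=
  @isOpen_interior P (scottT P) A

theorem isOpen_lowerT_compl_upSet {P : Type*} [Preorder P] {A : Set P} (hA : A.Finite) :
    @IsOpen P (lowerT P) (upSet A)ᶜ := by
  let := lowerT P
  have h : (upSet A)ᶜ = ⋂ a ∈ A, (Ici a)ᶜ := by
    ext y
    simp [upSet]
  rw [h]
  exact hA.isOpen_biInter fun a _ => TopologicalSpace.isOpen_generateFrom_of_mem ⟨a, rfl⟩

open scoped Classical in
/-- For a dyadically indexed family `F` with `↑F(b₂) ⊆ int_σ(↑F(b₁))` for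
`b₁ < b₂` in `B`, the function `f(y) = sup {b ∈ B : y ∈ ↑F(b)}` (for `y ∈ ↑F(0)`, else `0`)
has `f⁻¹((β,1]) = ⋃_{b ∈ B, b > β} int_σ(↑F(b))`, a Scott open set, and
`f⁻¹([0,α)) = (P ∖ ↑F(0)) ∪ ⋃_{b ∈ B, b < α} (P ∖ ↑F(b))`, open in the lower topology. -/
theorem preimages_of_urysohn_function
    (P : Type*) [PartialOrder P] (hdcpo : IsDcpo P)
    (F : ℝ → Set P)
    (hne : ∀ b ∈ dyadics, (F b).Nonempty) (hfin : ∀ b ∈ dyadics, (F b).Finite)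
    (hmono : ∀ b₁ ∈ dyadics, ∀ b₂ ∈ dyadics, b₁ < b₂ →
      upSet (F b₂) ⊆ scottInt P (upSet (F b₁)))
    (f : P → ℝ)
    (hf : ∀ y : P, f y =
      if y ∈ upSet (F 0) then sSup {b | b ∈ dyadics ∧ y ∈ upSet (F b)} else 0) :
    (∀ β : ℝ, β ∈ Set.Ico (0 : ℝ) 1 →
      f ⁻¹' Set.Ioc β 1 = ⋃ b ∈ {b | b ∈ dyadics ∧ β < b}, scottInt P (upSet (F b)) ∧
      @IsOpen P (scottT P) (f ⁻¹' Set.Ioc β 1)) ∧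
    (∀ α : ℝ, α ∈ Set.Ioc (0 : ℝ) 1 →
      f ⁻¹' Set.Ico 0 α =
        (upSet (F 0))ᶜ ∪ ⋃ b ∈ {b | b ∈ dyadics ∧ b < α}, (upSet (F b))ᶜ ∧
      @IsOpen P (lowerT P) (f ⁻¹' Set.Ico 0 α)) := by
  have hanti : ∀ b₁ ∈ dyadics, ∀ b₂ ∈ dyadics, b₁ ≤ b₂ → upSet (F b₂) ⊆ upSet (F b₁) := by
    intro b₁ h₁ b₂ h₂ h
    rcases h.eq_or_lt with rfl | h
    · exact Subset.rfl
    · exact (hmono b₁ h₁ b₂ h₂ h).trans (scottInt_subset _)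
  have hbdd : ∀ y, BddAbove {b | b ∈ dyadics ∧ y ∈ upSet (F b)} :=
    fun y => ⟨1, fun b hb => le_one_of_mem_dyadics hb.1⟩
  have hle : ∀ b ∈ dyadics, ∀ y ∈ upSet (F b), b ≤ f y := by
    intro b hb y hy
    rw [hf, if_pos (hanti 0 zero_mem_dyadics b hb (nonneg_of_mem_dyadics hb) hy)]
    exact le_csSup (hbdd y) ⟨hb, hy⟩
  have hlub : ∀ y ∈ upSet (F 0), IsLUB {b | b ∈ dyadics ∧ y ∈ upSet (F b)} (f y) := by
    intro y hy
    rw [hf, if_pos hy]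
    exact isLUB_csSup ⟨0, zero_mem_dyadics, hy⟩ (hbdd y)
  have hzero : ∀ y ∉ upSet (F 0), f y = 0 := fun y hy => by rw [hf, if_neg hy]
  have hnonneg : ∀ y, 0 ≤ f y := by
    intro y
    by_cases hy : y ∈ upSet (F 0)
    · exact hle 0 zero_mem_dyadics y hy
    · exact (hzero y hy).ge
  have hle_one : ∀ y, f y ≤ 1 := by
    intro y
    by_cases hy : y ∈ upSet (F 0)
    · exact (hlub y hy).2 fun b hb => le_one_of_mem_dyadics hb.1
    · exact (hzero y hy).trans_le zero_le_one
  refine ⟨fun β hβ => ?_, fun α hα => ?_⟩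
  · have heq : f ⁻¹' Set.Ioc β 1 =
        ⋃ b ∈ {b | b ∈ dyadics ∧ β < b}, scottInt P (upSet (F b)) := by
      ext y
      simp only [mem_preimage, mem_Ioc, mem_iUnion, mem_ofPred_eq, exists_prop]
      constructor
      · rintro ⟨hy, -⟩
        have hy0 : y ∈ upSet (F 0) := by
          by_contra h
          exact absurd (hzero y h) (hβ.1.trans_lt hy).ne'
        obtain ⟨b, ⟨hb, hyb⟩, hβb, -⟩ := (hlub y hy0).exists_between hy
        obtain ⟨c, hc, hβc, hcb⟩ :=
          exists_mem_dyadics_between hβ.1 hβb (le_one_of_mem_dyadics hb)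
        exact ⟨c, ⟨hc, hβc⟩, hmono c hc b hb hcb hyb⟩
      · rintro ⟨b, ⟨hb, hβb⟩, hy⟩
        exact ⟨hβb.trans_le (hle b hb y (scottInt_subset _ hy)), hle_one y⟩
    refine ⟨heq, ?_⟩
    rw [heq]
    exact @isOpen_biUnion P ℝ (scottT P) _ _ fun b _ => isOpen_scottInt _
  · have heq : f ⁻¹' Set.Ico 0 α =
        (upSet (F 0))ᶜ ∪ ⋃ b ∈ {b | b ∈ dyadics ∧ b < α}, (upSet (F b))ᶜ := by
      ext y
      simp only [mem_preimage, mem_Ico, mem_union, mem_compl_iff, mem_iUnion, mem_ofPred_eq,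
        exists_prop]
      constructor
      · rintro ⟨-, hy⟩
        obtain ⟨b, hb, hyb, hbα⟩ := exists_mem_dyadics_between (hnonneg y) hy hα.2
        exact Or.inr ⟨b, ⟨hb, hbα⟩, fun h => (hle b hb y h).not_gt hyb⟩
      · intro h
        refine ⟨hnonneg y, ?_⟩
        by_cases hy0 : y ∈ upSet (F 0)
        · obtain ⟨b, ⟨hb, hbα⟩, hyb⟩ := h.resolve_left (not_not.2 hy0)
          refine lt_of_le_of_lt ((hlub y hy0).2 fun c hc => ?_) hbα
          by_contra! hbc
          exact hyb (hanti b hb c hc.1 hbc.le hc.2)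
        · exact (hzero y hy0).trans_lt hα.1
    refine ⟨heq, ?_⟩
    rw [heq]
    exact @IsOpen.union P _ _ (lowerT P) (isOpen_lowerT_compl_upSet (hfin 0 zero_mem_dyadics))
      (@isOpen_biUnion P ℝ (lowerT P) _ _ fun b hb => isOpen_lowerT_compl_upSet (hfin b hb.1))
end

section
/- Let P be a meet-continuous dcpo and F a nonempty finite subset of P such that ↑F is Scott open. Then for every x ∈ ↑F there exists v ∈ F such that ↑v is Scott open and x ∈ ↑v ⊆ ↑F. -/
open Set

/-- In a meet-continuous dcpo, if `↑F` is Scott open for a nonempty finite `F`,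
then every `x ∈ ↑F` lies in some Scott open principal filter `↑v ⊆ ↑F` with `v ∈ F`. -/
theorem meetContinuous_scottOpen_upSet_refines
    (P : Type*) [PartialOrder P] (hdcpo : IsDcpo P) (hmc : MeetContinuous P)
    (F : Set P) (hFne : F.Nonempty) (hFfin : F.Finite) (hFopen : ScottOpen (upSet F)) :
    ∀ x ∈ upSet F, ∃ v ∈ F, ScottOpen (Set.Ici v) ∧ x ∈ Set.Ici v ∧ Set.Ici v ⊆ upSet F := by
  intro x hx
  obtain ⟨a, haF, hax⟩ := hx
  obtain ⟨v, hva, hv⟩ := hFfin.exists_le_minimal haF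
  refine ⟨v, hv.prop, ⟨isUpperSet_Ici v, fun D s hD hdir hlub hs => ?_⟩, hva.trans hax,
    fun y hy => ⟨v, hv.prop, hy⟩⟩
  have hcl := hmc v D s hD hdir hlub hs
  obtain ⟨w, ⟨f, hfF, hfw⟩, hwv, d, hdD, hwd⟩ :=
    (@mem_closure_iff P (scottT P) _ _).1 hcl (upSet F) hFopen ⟨v, hv.prop, le_rfl⟩
  exact ⟨d, hdD, (hv.le_of_le hfF (hfw.trans hwv)).trans (hfw.trans hwd)⟩
end
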